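/- Let Λ be the Lobachevsky function. For fixed U₁,U₂,U₃,U₄,V₁,V₂,V₃ with U₁+U₂+U₃+U₄ = V₁+V₂+V₃, the function g(Z) = ∑_{i=1}^4 Λ(Z-U_i) + ∑_{j=1}^3 Λ(V_j-Z) - Λ(Z) satisfies g(Z) ≤ 8Λ(π/8) for all Z. -/

import Mathlib

noncomputable def lob (x : ℝ) : ℝ := -∫ t in (0:ℝ)..x, Real.log |2 * Real.sin t|

open MeasureTheory in
theorem lob_int (a b : ℝ) :
    IntervalIntegrable (fun t => Real.log |2 * Real.sin t|) volume a b := by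
  have h : MeromorphicOn (fun t : ℝ => 2 * Real.sin t) (Set.uIcc a b) := by
    intro x _
    have : AnalyticAt ℝ (fun t : ℝ => 2 * Real.sin t) x := by fun_prop
    exact this.meromorphicAt
  have := h.intervalIntegrable_log
  refine this.congr ?_
  intro t _
  simp only [Function.comp, Real.log_abs]

theorem lob_cont : Continuous lob := by
  unfold lob
  exact (intervalIntegral.continuous_primitive lob_int 0).neg

theorem lob_zero : lob 0 = 0 := by simp [lob]

theorem lob_deriv {x : ℝ} (h0 : 0 < x) (h1 : x < Real.pi) :
    HasDerivAt lob (-Real.log (2 * Real.sin x)) x := by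
  have hs : 0 < Real.sin x := Real.sin_pos_of_pos_of_lt_pi h0 h1
  have hc : ContinuousAt (fun t => Real.log |2 * Real.sin t|) x := by
    apply ContinuousAt.log
    · fun_prop
    · positivity
  have hm : Measurable (fun t => Real.log |2 * Real.sin t|) := by fun_prop
  have := (intervalIntegral.integral_hasDerivAt_right (lob_int 0 x)
    hm.stronglyMeasurable.stronglyMeasurableAtFilter hc).neg
  rw [Real.log_abs] at this
  exact this

theorem lob_split (x : ℝ) (h : ∫ t in (0:ℝ)..x, Real.log (Real.sin t) = -Real.log 2 * x)
    (h1 : x ≤ Real.pi) (h0 : 0 ≤ x) : lob x = 0 := by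
  unfold lob
  have : ∫ t in (0:ℝ)..x, Real.log |2 * Real.sin t|
      = ∫ t in (0:ℝ)..x, (Real.log 2 + Real.log (Real.sin t)) := by
    apply intervalIntegral.integral_congr_Ioo_of_le h0
    intro t ht
    have hs : 0 < Real.sin t := Real.sin_pos_of_pos_of_lt_pi ht.1 (by linarith [ht.2])
    simp only
    rw [Real.log_abs, Real.log_mul (by norm_num) hs.ne']
  rw [this, intervalIntegral.integral_add (by simp) (by exact intervalIntegrable_log_sin), h]
  simp
  ring

theorem lob_pi : lob Real.pi = 0 :=
  lob_split _ integral_log_sin_zero_pi le_rfl Real.pi_pos.le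

theorem lob_pi2 : lob (Real.pi / 2) = 0 :=
  lob_split _ (by rw [integral_log_sin_zero_pi_div_two]; ring) (by linarith [Real.pi_pos])
    (by linarith [Real.pi_pos])

theorem lob_per : Function.Periodic lob Real.pi := by
  intro x
  have hp : Function.Periodic (fun t => Real.log |2 * Real.sin t|) Real.pi := by
    intro t; simp [Real.sin_add_pi]
  have h := hp.intervalIntegral_add_eq x 0
  have h2 := intervalIntegral.integral_add_adjacent_intervals (lob_int 0 x)
    (lob_int x (x + Real.pi))
  have h3 := lob_pi
  unfold lob at *
  rw [zero_add] at h
  linarith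

theorem lob_odd (x : ℝ) : lob (-x) = - lob x := by
  unfold lob
  have h := intervalIntegral.integral_comp_neg (a := 0) (b := x)
    (fun t => Real.log |2 * Real.sin t|)
  simp only [Real.sin_neg, mul_neg, abs_neg, neg_zero] at h
  rw [h, intervalIntegral.integral_symm]

theorem lob_mvt {a b : ℝ} (h0 : 0 ≤ a) (hab : a < b) (hb : b ≤ Real.pi) :
    ∃ c ∈ Set.Ioo a b, lob b - lob a = -Real.log (2 * Real.sin c) * (b - a) := by
  obtain ⟨c, hc, h⟩ := exists_hasDerivAt_eq_slope lob (fun x => -Real.log (2 * Real.sin x)) hab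
    lob_cont.continuousOn
    (fun x hx => lob_deriv (by linarith [hx.1]) (by linarith [hx.2]))
  refine ⟨c, hc, ?_⟩
  have : b - a ≠ 0 := by linarith
  rw [h]; field_simp

theorem lob_tangent {c x : ℝ} (hc0 : 0 < c) (hc : c ≤ Real.pi / 2) (h0 : 0 ≤ x)
    (h1 : x ≤ Real.pi / 2) :
    lob x ≤ lob c - Real.log (2 * Real.sin c) * (x - c) := by
  have hpi := Real.pi_pos
  rcases lt_trichotomy x c with h | h | h
  · obtain ⟨d, hd, e⟩ := lob_mvt h0 h (by linarith)
    have hs : 0 < Real.sin d := Real.sin_pos_of_pos_of_lt_pi (by linarith [hd.1]) (by linarith [hd.2])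
    have : Real.log (2 * Real.sin d) ≤ Real.log (2 * Real.sin c) := by
      apply Real.log_le_log (by positivity)
      have := Real.sin_le_sin_of_le_of_le_pi_div_two (by linarith [hd.1]) hc hd.2.le
      linarith
    nlinarith
  · simp [h]
  · obtain ⟨d, hd, e⟩ := lob_mvt hc0.le h (by linarith)
    have hs : 0 < Real.sin c := Real.sin_pos_of_pos_of_lt_pi (by linarith [hd.1]) (by linarith [hd.2])
    have : Real.log (2 * Real.sin c) ≤ Real.log (2 * Real.sin d) := by
      apply Real.log_le_log (by positivity)
      have := Real.sin_le_sin_of_le_of_le_pi_div_two (by linarith [hd.1]) (by linarith [hd.2]) hd.1.le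
      linarith
    nlinarith

theorem lob_nonpos {x : ℝ} (h0 : Real.pi / 2 ≤ x) (h1 : x ≤ Real.pi) : lob x ≤ 0 := by
  have hpi := Real.pi_pos
  rcases h0.eq_or_lt with h | h0
  · rw [← h, lob_pi2]
  rcases h1.eq_or_lt with h | h1
  · rw [h, lob_pi]
  obtain ⟨c, hc, e⟩ := lob_mvt (by linarith) h0 h1.le
  obtain ⟨d, hd, f⟩ := lob_mvt (by linarith) h1 le_rfl
  rw [lob_pi2] at e
  rw [lob_pi] at f
  have hs : 0 < Real.sin d := Real.sin_pos_of_pos_of_lt_pi (by linarith [hd.1]) hd.2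
  have : Real.log (2 * Real.sin d) ≤ Real.log (2 * Real.sin c) := by
    apply Real.log_le_log (by positivity)
    have := Real.sin_le_sin_of_le_of_le_pi_div_two (x := Real.pi - d) (y := Real.pi - c)
      (by linarith [hd.2]) (by linarith [hc.1]) (by linarith [hd.1, hc.2])
    rw [Real.sin_pi_sub, Real.sin_pi_sub] at this
    linarith
  by_contra! hx
  have a1 : Real.log (2 * Real.sin c) < 0 := by
    by_contra! hh
    nlinarith
  nlinarith

theorem aux_cont : Continuous (fun x : ℝ => x - (x * Real.log 2 + x * Real.log x)) := by
  have := Real.continuous_mul_log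
  fun_prop

theorem aux_deriv {x : ℝ} (hx : 0 < x) :
    HasDerivAt (fun x : ℝ => x - (x * Real.log 2 + x * Real.log x))
      (-(Real.log 2 + Real.log x)) x := by
  have h := (hasDerivAt_id x).sub (((hasDerivAt_id x).mul_const (Real.log 2)).add
    (Real.hasDerivAt_mul_log hx.ne'))
  refine h.congr_deriv ?_
  ring

theorem lob_lower {c : ℝ} (h0 : 0 < c) (h1 : c ≤ 1) :
    c - (c * Real.log 2 + c * Real.log c) ≤ lob c := by
  have hp := Real.pi_gt_three
  obtain ⟨d, hd, e⟩ := exists_hasDerivAt_eq_slope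
    (fun x => lob x - (x - (x * Real.log 2 + x * Real.log x)))
    (fun x => -Real.log (2 * Real.sin x) - (-(Real.log 2 + Real.log x))) h0
    (lob_cont.sub aux_cont).continuousOn
    (fun x hx => (lob_deriv hx.1 (by linarith [hx.2])).sub (aux_deriv hx.1))
  have hd0 := hd.1
  have hs : 0 < Real.sin d := Real.sin_pos_of_pos_of_lt_pi hd.1 (by linarith [hd.2])
  simp only [lob_zero] at e
  rw [Real.log_mul (by norm_num) hs.ne', eq_div_iff (by linarith)] at e
  have : Real.log (Real.sin d) ≤ Real.log d := Real.log_le_log hs (Real.sin_le hd.1.le)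
  nlinarith

theorem lob_upper {c : ℝ} (h0 : 0 < c) (h1 : c ≤ 4 / 5) :
    lob c ≤ c - (c * Real.log 2 + c * Real.log c) + c ^ 3 / 16 := by
  have hp := Real.pi_gt_three
  obtain ⟨d, hd, e⟩ := exists_hasDerivAt_eq_slope
    (fun x => lob x - (x - (x * Real.log 2 + x * Real.log x)) - x ^ 3 / 16)
    (fun x => -Real.log (2 * Real.sin x) - (-(Real.log 2 + Real.log x)) - 3 * x ^ 2 / 16) h0
    ((lob_cont.sub aux_cont).sub (by fun_prop)).continuousOn
    (fun x hx => ((lob_deriv hx.1 (by linarith [hx.2])).sub (aux_deriv hx.1)).sub (by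
      simpa using (hasDerivAt_pow 3 x).div_const 16))
  have hd0 := hd.1
  have hd1 := hd.2
  have hs : 0 < Real.sin d := Real.sin_pos_of_pos_of_lt_pi hd.1 (by linarith [hd.2])
  simp only [lob_zero] at e
  rw [Real.log_mul (by norm_num) hs.ne', eq_div_iff (by linarith)] at e
  have hu : d ^ 2 ≤ 16 / 25 := by nlinarith
  have hu0 : 0 < 1 - d ^ 2 / 6 := by linarith
  have h2 : Real.log (d * (1 - d ^ 2 / 6)) ≤ Real.log (Real.sin d) := by
    apply Real.log_le_log (by positivity)
    have := Real.sin_gt_sub_cube hd0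
    linarith
  rw [Real.log_mul hd0.ne' hu0.ne'] at h2
  have h3 := Real.one_sub_inv_le_log_of_pos hu0
  have h4 : (1 - d ^ 2 / 6)⁻¹ ≤ 1 + 3 * d ^ 2 / 16 := by
    rw [inv_le_iff_one_le_mul₀ hu0]
    nlinarith [sq_nonneg d]
  nlinarith

theorem log_pi_lo : 1.1436 ≤ Real.log Real.pi := by
  have h := Real.one_sub_inv_le_log_of_pos (x := Real.pi / 3) (by positivity)
  rw [Real.log_div Real.pi_ne_zero (by norm_num)] at h
  have : (Real.pi / 3)⁻¹ ≤ 0.95497 := by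
    rw [inv_le_iff_one_le_mul₀ (by positivity)]
    linarith [Real.pi_gt_d4]
  linarith [Real.log_three_gt_d9]

theorem log_pi_hi : Real.log Real.pi ≤ 1.14582 := by
  have h := Real.log_le_sub_one_of_pos (x := Real.pi / 3) (by positivity)
  rw [Real.log_div Real.pi_ne_zero (by norm_num)] at h
  linarith [Real.log_three_lt_d9, Real.pi_lt_d4]

theorem L_lo : 0.487 ≤ lob (Real.pi / 8) := by
  have h := lob_lower (c := Real.pi / 8) (by positivity) (by linarith [Real.pi_lt_four])
  have h8 : Real.log 8 = 3 * Real.log 2 := by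
    rw [show (8:ℝ) = 2 ^ 3 by norm_num, Real.log_pow]; norm_num
  rw [Real.log_div Real.pi_ne_zero (by norm_num), h8] at h
  have h1 := log_pi_hi
  have h2 := Real.log_two_gt_d9
  have h3 := Real.pi_gt_d4
  nlinarith

theorem L6_hi : lob (Real.pi / 6) ≤ 0.51 := by
  have h := lob_upper (c := Real.pi / 6) (by positivity) (by linarith [Real.pi_lt_d4])
  have h8 : Real.log 6 = Real.log 2 + Real.log 3 := by
    rw [show (6:ℝ) = 2 * 3 by norm_num, Real.log_mul (by norm_num) (by norm_num)]
  rw [Real.log_div Real.pi_ne_zero (by norm_num), h8] at h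
  have h1 := log_pi_lo
  have h2 := Real.log_three_lt_d9
  have h3 := Real.pi_gt_d4
  have h4 := Real.pi_lt_d4
  have h5 : Real.pi ^ 3 ≤ 3.1416 ^ 3 := by gcongr
  norm_num at h5
  nlinarith

theorem L4_hi : lob (Real.pi / 4) ≤ 0.4625 := by
  have h := lob_upper (c := Real.pi / 4) (by positivity) (by linarith [Real.pi_lt_d4])
  have h8 : Real.log 4 = 2 * Real.log 2 := by
    rw [show (4:ℝ) = 2 ^ 2 by norm_num, Real.log_pow]; norm_num
  rw [Real.log_div Real.pi_ne_zero (by norm_num), h8] at h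
  have h1 := log_pi_lo
  have h2 := Real.log_two_lt_d9
  have h3 := Real.pi_gt_d4
  have h4 := Real.pi_lt_d4
  have h5 : Real.pi ^ 3 ≤ 3.1416 ^ 3 := by gcongr
  norm_num at h5
  nlinarith

theorem lob_line2 {x : ℝ} (h0 : 0 ≤ x) (h1 : x ≤ Real.pi) :
    lob x ≤ 4 / 3 * lob (Real.pi / 8) * (1 - x / Real.pi) := by
  have hL := L_lo
  have hp := Real.pi_pos
  have hp4 := Real.pi_lt_d4
  have hp3 := Real.pi_gt_d4
  have hq : 0 ≤ 1 - x / Real.pi := by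
    rw [sub_nonneg, div_le_one hp]; exact h1
  have hmono : 4 / 3 * 0.487 * (1 - x / Real.pi) ≤
      4 / 3 * lob (Real.pi / 8) * (1 - x / Real.pi) := by gcongr
  rcases le_total (Real.pi / 2) x with h | h
  · have := lob_nonpos h h1
    have : 0 ≤ 4 / 3 * 0.487 * (1 - x / Real.pi) := by positivity
    linarith
  refine le_trans ?_ hmono
  obtain ⟨y, rfl⟩ : ∃ y, x = Real.pi * y := ⟨x / Real.pi, by field_simp⟩
  rw [mul_div_cancel_left₀ _ hp.ne']
  rcases le_total y (5 / 24) with hy | hy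
  · have := lob_tangent (c := Real.pi / 6) (by positivity) (by linarith) h0 h
    rw [Real.sin_pi_div_six] at this
    norm_num at this
    linarith [L6_hi]
  · have := lob_tangent (c := Real.pi / 4) (by positivity) (by linarith) h0 h
    have e : Real.log (2 * Real.sin (Real.pi / 4)) = Real.log 2 / 2 := by
      rw [Real.sin_pi_div_four, mul_div_cancel₀ _ (by norm_num), Real.log_sqrt (by norm_num)]
    rw [e] at this
    have h2 := Real.log_two_lt_d9
    have h3 := Real.log_two_gt_d9
    have h5 := L4_hi
    have h6 : 2.177 ≤ Real.log 2 * Real.pi := by nlinarith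
    have h7 : Real.log 2 * Real.pi ≤ 2.178 := by nlinarith
    have : Real.log 2 / 2 * (Real.pi * y - Real.pi / 4)
      = (Real.log 2 * Real.pi) * ((y - 5 / 24) / 2) - (Real.log 2 * Real.pi) / 48 := by ring
    have : 2.177 * ((y - 5 / 24) / 2) ≤ (Real.log 2 * Real.pi) * ((y - 5 / 24) / 2) := by
      gcongr
    linarith

theorem slope_nonpos : Real.log (2 * Real.sin (Real.pi / 8)) ≤ 0 := by
  have hp := Real.pi_pos
  have hs : 0 < Real.sin (Real.pi / 8) :=
    Real.sin_pos_of_pos_of_lt_pi (by linarith) (by linarith)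
  apply Real.log_nonpos (by positivity)
  have := Real.sin_le (x := Real.pi / 8) (by linarith)
  linarith [Real.pi_lt_four]

theorem lob_line1 {x : ℝ} (h0 : 0 ≤ x) (h1 : x ≤ Real.pi) :
    lob x ≤ lob (Real.pi / 8) - Real.log (2 * Real.sin (Real.pi / 8)) * (x - Real.pi / 8) := by
  have hp := Real.pi_pos
  rcases le_total (Real.pi / 2) x with h | h
  · have := lob_nonpos h h1
    have := L_lo
    have := slope_nonpos
    nlinarith
  · exact lob_tangent (by positivity) (by linarith) h0 h

theorem lob_main (x : Fin 8 → ℝ) (h : ∑ i, x i = 0) : ∑ i, lob (x i) ≤ 8 * lob (Real.pi / 8) := by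
  have hp := Real.pi_pos
  let y : Fin 8 → ℝ := fun i => x i - ⌊x i / Real.pi⌋ * Real.pi
  have hy0 : ∀ i, 0 ≤ y i := fun i => by
    have := Int.floor_le (x i / Real.pi)
    rw [le_div_iff₀ hp] at this
    simp only [y]; linarith
  have hy1 : ∀ i, y i ≤ Real.pi := fun i => by
    have := (Int.lt_floor_add_one (x i / Real.pi)).le
    rw [div_le_iff₀ hp] at this
    simp only [y]; linarith
  have hl : ∀ i, lob (x i) = lob (y i) := fun i => (lob_per.sub_int_mul_eq _).symm
  obtain ⟨k, hk⟩ : ∃ k : ℤ, ∑ i, y i = k * Real.pi := by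
    refine ⟨-∑ i, ⌊x i / Real.pi⌋, ?_⟩
    simp only [y, Finset.sum_sub_distrib, h, ← Finset.sum_mul]
    push_cast; ring
  simp only [hl]
  rcases le_or_gt k 1 with h1 | h1
  · have hk1 : (k : ℝ) ≤ 1 := by exact_mod_cast h1
    calc ∑ i, lob (y i) ≤ ∑ i, (lob (Real.pi / 8)
          - Real.log (2 * Real.sin (Real.pi / 8)) * (y i - Real.pi / 8)) :=
          Finset.sum_le_sum fun i _ => lob_line1 (hy0 i) (hy1 i)
      _ = 8 * lob (Real.pi / 8)
          - Real.log (2 * Real.sin (Real.pi / 8)) * ((k - 1) * Real.pi) := by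
          rw [Finset.sum_sub_distrib, ← Finset.mul_sum, Finset.sum_sub_distrib, hk]
          simp
          left
          ring
      _ ≤ _ := by
          have := slope_nonpos
          have : 0 ≤ Real.log (2 * Real.sin (Real.pi / 8)) * ((k - 1) * Real.pi) :=
            mul_nonneg_of_nonpos_of_nonpos this
              (mul_nonpos_of_nonpos_of_nonneg (by linarith) hp.le)
          linarith
  · have hk1 : (2 : ℝ) ≤ k := by exact_mod_cast h1
    calc ∑ i, lob (y i) ≤ ∑ i, (4 / 3 * lob (Real.pi / 8) * (1 - y i / Real.pi)) :=
          Finset.sum_le_sum fun i _ => lob_line2 (hy0 i) (hy1 i)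
      _ = 4 / 3 * lob (Real.pi / 8) * (8 - k) := by
          rw [← Finset.mul_sum, Finset.sum_sub_distrib, ← Finset.sum_div, hk]
          rw [mul_div_cancel_right₀ _ hp.ne']
          simp
      _ ≤ _ := by
          have := L_lo
          nlinarith

theorem stmt_17 (U : Fin 4 → ℝ) (V : Fin 3 → ℝ)
    (hsum : ∑ i, U i = ∑ j, V j) (Z : ℝ) :
    (∑ i, lob (Z - U i)) + (∑ j, lob (V j - Z)) - lob Z
      ≤ 8 * lob (Real.pi / 8) := by
  have h := lob_main ![Z - U 0, Z - U 1, Z - U 2, Z - U 3, V 0 - Z, V 1 - Z, V 2 - Z, -Z] (by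
    simp only [Fin.sum_univ_eight, Fin.sum_univ_four, Fin.sum_univ_three] at hsum ⊢
    simp
    linarith)
  simp only [Fin.sum_univ_eight, Fin.sum_univ_four, Fin.sum_univ_three] at h ⊢
  simp [lob_odd] at h
  linarith
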